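/- Let Ω and Θ be finite sets with Θ nonempty, and let m be a mass function on Ω. Define the vacuous extension m↑ : Finset (Ω × Θ) → ℝ by m↑(G) = m(F) if G = F ×ˢ Θ for some F ⊆ Ω, and m↑(G) = 0 otherwise, and define the marginalization of any M : Finset (Ω × Θ) → ℝ onto Ω by M↓(F) = Σ over G ⊆ Ω × Θ whose image under the first projection equals F of M(G). Then marginalization inverts vacuous extension: (m↑)↓ = m, i.e., for every F ⊆ Ω, (m↑)↓(F) = m(F). -/

import Mathlib

open Finset

/-- The vacuous extension of `m : Finset Ω → ℝ` to `Ω × Θ`: it places `m(F)` on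
`F ×ˢ Θ` and `0` elsewhere. -/
noncomputable def vacuousExtension {Ω Θ : Type*} [Fintype Ω] [DecidableEq Ω]
    [Fintype Θ] [DecidableEq Θ] (m : Finset Ω → ℝ) (G : Finset (Ω × Θ)) : ℝ :=
  if h : ∃ F : Finset Ω, G = F ×ˢ (Finset.univ : Finset Θ) then m h.choose else 0

/-- The marginalization of `M : Finset (Ω × Θ) → ℝ` onto `Ω`:
`M↓(F) = Σ_{G : image of G under fst = F} M(G)`. -/
def marginalization {Ω Θ : Type*} [Fintype Ω] [DecidableEq Ω]
    [Fintype Θ] [DecidableEq Θ] (M : Finset (Ω × Θ) → ℝ) (F : Finset Ω) : ℝ :=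
  ∑ G ∈ Finset.univ.filter (fun G : Finset (Ω × Θ) => G.image Prod.fst = F), M G

theorem image_fst_product_univ {Ω Θ : Type*} [DecidableEq Ω] [Fintype Θ] [Nonempty Θ]
    (F : Finset Ω) : (F ×ˢ (Finset.univ : Finset Θ)).image Prod.fst = F :=
  Finset.product_image_fst Finset.univ_nonempty

theorem vacuousExtension_product_univ {Ω Θ : Type*} [Fintype Ω] [DecidableEq Ω]
    [Fintype Θ] [DecidableEq Θ] [Nonempty Θ] (m : Finset Ω → ℝ) (F : Finset Ω) :
    vacuousExtension m (F ×ˢ (Finset.univ : Finset Θ)) = m F := by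
  have h : ∃ F' : Finset Ω, F ×ˢ (Finset.univ : Finset Θ) = F' ×ˢ Finset.univ := ⟨F, rfl⟩
  have hF : h.choose = F := by
    have := congrArg (Finset.image Prod.fst) h.choose_spec
    rwa [image_fst_product_univ, image_fst_product_univ, eq_comm] at this
  rw [vacuousExtension, dif_pos h, hF]

theorem vacuousExtension_eq_zero {Ω Θ : Type*} [Fintype Ω] [DecidableEq Ω]
    [Fintype Θ] [DecidableEq Θ] (m : Finset Ω → ℝ) {G : Finset (Ω × Θ)}
    (hG : ∀ F : Finset Ω, G ≠ F ×ˢ Finset.univ) : vacuousExtension m G = 0 :=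
  dif_neg fun ⟨F, hF⟩ => hG F hF

/-- Marginalization inverts the vacuous extension: `(m↑)↓ = m`. -/
theorem marginalization_vacuousExtension {Ω Θ : Type*} [Fintype Ω] [DecidableEq Ω]
    [Fintype Θ] [DecidableEq Θ] [Nonempty Θ]
    (m : Finset Ω → ℝ) (hm : ∀ F, 0 ≤ m F) (hm1 : ∑ F : Finset Ω, m F = 1) :
    ∀ F : Finset Ω, marginalization (vacuousExtension (Θ := Θ) m) F = m F := by
  intro F
  rw [marginalization, Finset.sum_eq_single (F ×ˢ Finset.univ),
    vacuousExtension_product_univ]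
  · intro G hG hne
    refine vacuousExtension_eq_zero m ?_
    rintro F' rfl
    rw [Finset.mem_filter, image_fst_product_univ] at hG
    exact hne (by rw [hG.2])
  · intro h
    simp only [Finset.mem_filter, Finset.mem_univ, true_and] at h
    exact absurd (image_fst_product_univ F) h
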